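/- The number of parking functions of size n whose parking permutation avoids both 123 and 213 equals (1/2)·(1−√2)^n + (1/2)·(1+√2)^n; equivalently, the sequence p_n satisfies p_1 = 1, p_2 = 3, and p_{n+1} = 2p_n + p_{n−1}. -/

import Mathlib

open Finset

noncomputable section

/-- The parking process over the first `k` cars (cars are `0,...,k-1`, i.e. cars `1,...,k`
in 1-indexed terms): returns `some occ` where `occ` maps each spot to the car parked there
(`none` meaning empty), or `none` if some car failed to park.  Car `c` drives to its
preferred spot `f c` and parks at the first free spot with index `≥ f c`, failing if
no such spot exists. -/
def parkAux {n : ℕ} (f : Fin n → Fin n) : ℕ → Option (Fin n → Option (Fin n))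
  | 0 => some fun _ => none
  | k + 1 =>
    (parkAux f k).bind fun occ =>
      if h : k < n then
        if hS : (Finset.univ.filter fun s => f ⟨k, h⟩ ≤ s ∧ occ s = none).Nonempty then
          some (Function.update occ
            ((Finset.univ.filter fun s => f ⟨k, h⟩ ≤ s ∧ occ s = none).min' hS)
            (some ⟨k, h⟩))
        else none
      else some occ

/-- All `n` cars park successfully. -/
def AllPark {n : ℕ} (f : Fin n → Fin n) : Prop := (parkAux f n).isSome

/-- `f` is a parking function: for every `i ∈ [n]`, at least `i` cars prefer
the first `i` spots.  (Here `i : Fin n` denotes the `(i+1)`-st spot, 0-indexed.) -/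
def IsParkingFunction {n : ℕ} (f : Fin n → Fin n) : Prop :=
  ∀ i : Fin n, i.val + 1 ≤ (Finset.univ.filter fun j => f j ≤ i).card

/-- `ρ` is the parking permutation of `f`: after all cars have parked,
spot `i` is occupied by car `ρ i`. -/
def IsParkingPerm {n : ℕ} (f : Fin n → Fin n) (ρ : Equiv.Perm (Fin n)) : Prop :=
  parkAux f n = some fun i => some (ρ i)

/-- `π` contains `σ` as a pattern. -/
def ContainsPattern {n m : ℕ} (π : Equiv.Perm (Fin n)) (σ : Equiv.Perm (Fin m)) : Prop :=
  ∃ g : Fin m → Fin n, StrictMono g ∧ ∀ a b : Fin m, σ a < σ b ↔ π (g a) < π (g b)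

/-- `ρ` avoids every pattern in the list `pats`. -/
def AvoidsAll {n : ℕ} (ρ : Equiv.Perm (Fin n)) (pats : List (Equiv.Perm (Fin 3))) : Prop :=
  ∀ σ ∈ pats, ¬ ContainsPattern ρ σ

/-- The number of parking functions of size `n` whose parking permutation avoids
all patterns in `pats`. -/
def pk (n : ℕ) (pats : List (Equiv.Perm (Fin 3))) : ℕ :=
  Nat.card {f : Fin n → Fin n // IsParkingFunction f ∧
    ∃ ρ : Equiv.Perm (Fin n), IsParkingPerm f ρ ∧ AvoidsAll ρ pats}

def p123 : Equiv.Perm (Fin 3) := Equiv.ofBijective ![0, 1, 2] (by decide)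
def p132 : Equiv.Perm (Fin 3) := Equiv.ofBijective ![0, 2, 1] (by decide)
def p213 : Equiv.Perm (Fin 3) := Equiv.ofBijective ![1, 0, 2] (by decide)
def p231 : Equiv.Perm (Fin 3) := Equiv.ofBijective ![1, 2, 0] (by decide)
def p312 : Equiv.Perm (Fin 3) := Equiv.ofBijective ![2, 0, 1] (by decide)
def p321 : Equiv.Perm (Fin 3) := Equiv.ofBijective ![2, 1, 0] (by decide)

/-! ### Helper material -/

/-- Avoidance of 123 and 213, unfolded. -/
def HAv {n : ℕ} (ρ : Equiv.Perm (Fin n)) : Prop :=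
  ∀ i j k : Fin n, i < j → j < k → ρ i < ρ k → ¬ ρ j < ρ k

/-- Marks sit on ascents. -/
def HMk {n : ℕ} (ρ : Equiv.Perm (Fin n)) (m : Fin n → Bool) : Prop :=
  ∀ i, m i = true → ∃ j : Fin n, j.val + 1 = i.val ∧ ρ j < ρ i

/-- Insert the new largest value at position `p`. -/
def insP {n : ℕ} (p : Fin (n+1)) (ρ : Equiv.Perm (Fin n)) : Equiv.Perm (Fin (n+1)) :=
  (finSuccEquiv' p).trans ((Equiv.optionCongr ρ).trans (finSuccEquiv' (Fin.last n)).symm)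

theorem insP_self {n : ℕ} (p : Fin (n+1)) (ρ : Equiv.Perm (Fin n)) :
    insP p ρ p = Fin.last n := by simp [insP]

theorem insP_succAbove {n : ℕ} (p : Fin (n+1)) (ρ : Equiv.Perm (Fin n)) (j : Fin n) :
    insP p ρ (p.succAbove j) = (ρ j).castSucc := by simp [insP]

theorem insP_surj {n : ℕ} (p : Fin (n+1)) (σ : Equiv.Perm (Fin (n+1))) (h : σ p = Fin.last n) :
    ∃ ρ, insP p ρ = σ := by
  have hne : ∀ j, σ (p.succAbove j) ≠ Fin.last n := by
    intro j hj
    rw [← h] at hj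
    exact Fin.succAbove_ne p j (σ.injective hj)
  let g : Fin n → Fin n := fun j => (σ (p.succAbove j)).castPred (hne j)
  have hg : Function.Injective g := by
    intro a b hab
    have h1 : σ (p.succAbove a) = σ (p.succAbove b) := by
      have := congrArg Fin.castSucc hab
      simpa [g] using this
    exact Fin.succAbove_right_injective (σ.injective h1)
  refine ⟨Equiv.ofBijective g (Finite.injective_iff_bijective.mp hg), ?_⟩
  ext k
  rcases Fin.eq_self_or_eq_succAbove p k with rfl | ⟨j, rfl⟩
  · rw [insP_self, h]
  · rw [insP_succAbove]; simp [g]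

theorem insP_inj {n : ℕ} (p : Fin (n+1)) (ρ ρ' : Equiv.Perm (Fin n))
    (h : insP p ρ = insP p ρ') : ρ = ρ' := by
  ext j
  have := congrArg (fun s => s (p.succAbove j)) h
  simp only [insP_succAbove] at this
  exact congrArg Fin.val (Fin.castSucc_injective _ this)

theorem HAv_pos {n : ℕ} (σ : Equiv.Perm (Fin (n+1))) (p : Fin (n+1)) (h : σ p = Fin.last n)
    (hA : HAv σ) : p.val ≤ 1 := by
  by_contra hp
  push Not at hp
  have hlt : ∀ q, q ≠ p → σ q < σ p := by
    intro q hq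
    rw [h]
    refine lt_of_le_of_ne (Fin.le_last _) ?_
    rw [← h]
    exact fun e => hq (σ.injective e)
  have hb := p.2
  refine hA ⟨0, by omega⟩ ⟨1, by omega⟩ p ?_ ?_ (hlt _ ?_) (hlt _ ?_)
  · simp [Fin.lt_def]
  · simp [Fin.lt_def]; omega
  · intro e; rw [← e] at hp; simp at hp
  · intro e; rw [← e] at hp; simp at hp

theorem HAv_ins {n : ℕ} (p : Fin (n+1)) (hp : p.val ≤ 1) (ρ : Equiv.Perm (Fin n)) :
    HAv (insP p ρ) ↔ HAv ρ := by
  constructor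
  · intro h i j k hij hjk h1 h2
    refine h (p.succAbove i) (p.succAbove j) (p.succAbove k) ?_ ?_ ?_ ?_
    · exact Fin.strictMono_succAbove p hij
    · exact Fin.strictMono_succAbove p hjk
    · simpa [insP_succAbove] using h1
    · simpa [insP_succAbove] using h2
  · intro h i j k hij hjk h1 h2
    rcases Fin.eq_self_or_eq_succAbove p k with rfl | ⟨k, rfl⟩
    · rw [Fin.lt_def] at hij hjk; omega
    rcases Fin.eq_self_or_eq_succAbove p i with rfl | ⟨i, rfl⟩
    · rw [insP_self] at h1; exact absurd h1 (not_lt.mpr (Fin.le_last _))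
    rcases Fin.eq_self_or_eq_succAbove p j with rfl | ⟨j, rfl⟩
    · rw [insP_self] at h2; exact absurd h2 (not_lt.mpr (Fin.le_last _))
    simp only [insP_succAbove, Fin.castSucc_lt_castSucc_iff] at h1 h2
    exact h i j k ((Fin.strictMono_succAbove p).lt_iff_lt.mp hij)
      ((Fin.strictMono_succAbove p).lt_iff_lt.mp hjk) h1 h2

theorem insP_not_lt {n : ℕ} (p : Fin (n+1)) (ρ : Equiv.Perm (Fin n)) (k : Fin (n+1)) :
    ¬ insP p ρ p < k := by
  rw [insP_self]; exact not_lt.mpr (Fin.le_last _)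

theorem HMk_zero {n : ℕ} (ρ : Equiv.Perm (Fin n)) (b : Bool) (m : Fin n → Bool) :
    HMk (insP 0 ρ) (Fin.insertNth 0 b m : Fin (n+1) → Bool) ↔ b = false ∧ HMk ρ m := by
  constructor
  · intro h
    constructor
    · by_contra hb
      obtain ⟨j, hj, _⟩ := h 0 (by simpa using hb)
      simp at hj
    · intro i hi
      obtain ⟨j, hj, hlt⟩ := h ((0 : Fin (n+1)).succAbove i) (by rw [Fin.insertNth_apply_succAbove]; exact hi)
      rcases Fin.eq_self_or_eq_succAbove 0 j with rfl | ⟨j, rfl⟩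
      · exact absurd hlt (insP_not_lt _ _ _)
      · refine ⟨j, by simpa using hj, ?_⟩
        simpa only [insP_succAbove, Fin.castSucc_lt_castSucc_iff] using hlt
  · rintro ⟨rfl, h⟩ i hi
    rcases Fin.eq_self_or_eq_succAbove 0 i with rfl | ⟨i, rfl⟩
    · simp at hi
    · rw [Fin.insertNth_apply_succAbove] at hi
      obtain ⟨j, hj, hlt⟩ := h i hi
      refine ⟨(0 : Fin (n+1)).succAbove j, by simpa using hj, ?_⟩
      simpa only [insP_succAbove, Fin.castSucc_lt_castSucc_iff] using hlt

theorem succAbove_one_val {n : ℕ} (j : Fin (n+1)) :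
    ((1 : Fin (n+2)).succAbove j).val = if j.val = 0 then 0 else j.val + 1 := by
  by_cases h : j.val = 0
  · have : j = 0 := Fin.ext h
    subst this; simp [Fin.succAbove]
  · rw [Fin.succAbove_of_le_castSucc]
    · simp [h]
    · rw [Fin.le_def]; simp; omega

theorem HMk_one {n : ℕ} (ρ : Equiv.Perm (Fin (n+1))) (b : Bool) (m : Fin (n+1) → Bool) :
    HMk (insP 1 ρ) (Fin.insertNth 1 b m : Fin (n+2) → Bool) ↔
      HMk ρ m ∧ ∀ i, i.val = 1 → m i = false := by
  constructor
  · intro h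
    have key : ∀ i, m i = true → i.val ≠ 1 ∧ ∃ j, j.val + 1 = i.val ∧ ρ j < ρ i := by
      intro i hi
      obtain ⟨j, hj, hlt⟩ := h ((1 : Fin (n+2)).succAbove i)
        (by rw [Fin.insertNth_apply_succAbove]; exact hi)
      rcases Fin.eq_self_or_eq_succAbove 1 j with rfl | ⟨j, rfl⟩
      · exact absurd hlt (insP_not_lt _ _ _)
      · simp only [succAbove_one_val] at hj
        simp only [insP_succAbove, Fin.castSucc_lt_castSucc_iff] at hlt
        refine ⟨?_, j, ?_, hlt⟩
        · split_ifs at hj <;> omega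
        · split_ifs at hj <;> omega
    refine ⟨fun i hi => (key i hi).2, fun i hi => ?_⟩
    by_contra hb
    exact (key i (by simpa using hb)).1 hi
  · rintro ⟨h, h1⟩ i hi
    rcases Fin.eq_self_or_eq_succAbove 1 i with rfl | ⟨i, rfl⟩
    · refine ⟨(1 : Fin (n+2)).succAbove 0, by rw [succAbove_one_val]; simp, ?_⟩
      rw [insP_succAbove, insP_self]
      exact Fin.castSucc_lt_last _
    · rw [Fin.insertNth_apply_succAbove] at hi
      obtain ⟨j, hj, hlt⟩ := h i hi
      have hi1 : i.val ≠ 1 := by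
        intro e; rw [h1 i e] at hi; simp at hi
      refine ⟨(1 : Fin (n+2)).succAbove j, ?_, ?_⟩
      · simp only [succAbove_one_val]
        split_ifs <;> omega
      · simpa only [insP_succAbove, Fin.castSucc_lt_castSucc_iff] using hlt

/-- Avoiding permutations with marked ascents. -/
def HA (n : ℕ) : Set (Equiv.Perm (Fin n) × (Fin n → Bool)) :=
  {x | HAv x.1 ∧ HMk x.1 x.2}

/-- Those with position 1 not marked. -/
def HB (n : ℕ) : Set (Equiv.Perm (Fin n) × (Fin n → Bool)) :=
  {x | x ∈ HA n ∧ ∀ i, i.val = 1 → x.2 i = false}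

/-- Insertion on pairs. -/
def HF {n : ℕ} (p : Fin (n+1)) (b : Bool) (x : Equiv.Perm (Fin n) × (Fin n → Bool)) :
    Equiv.Perm (Fin (n+1)) × (Fin (n+1) → Bool) :=
  (insP p x.1, (Fin.insertNth p b x.2 : Fin (n+1) → Bool))

theorem HF_inj {n : ℕ} (p : Fin (n+1)) (b : Bool) : Function.Injective (HF p b) := by
  rintro ⟨ρ, m⟩ ⟨ρ', m'⟩ h
  simp only [HF, Prod.mk.injEq] at h
  refine Prod.ext (insP_inj p _ _ h.1) ?_
  funext j
  have := congrFun h.2 (p.succAbove j)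
  simpa only [Fin.insertNth_apply_succAbove] using this

theorem HF_ne {n : ℕ} (p q : Fin (n+1)) (b c : Bool) (x y : Equiv.Perm (Fin n) × (Fin n → Bool))
    (h : HF p b x = HF q c y) : p = q ∧ b = c := by
  simp only [HF, Prod.mk.injEq] at h
  have hpq : p = q := by
    apply (insP p x.1).injective
    rw [insP_self, h.1, insP_self]
  subst hpq
  refine ⟨rfl, ?_⟩
  have := congrFun h.2 p
  simpa only [Fin.insertNth_apply_same] using this

theorem HF_surj {n : ℕ} (p : Fin (n+1)) (y : Equiv.Perm (Fin (n+1)) × (Fin (n+1) → Bool))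
    (h : y.1 p = Fin.last n) : ∃ b x, HF p b x = y := by
  obtain ⟨ρ, hρ⟩ := insP_surj p y.1 h
  refine ⟨y.2 p, (ρ, fun j => y.2 (p.succAbove j)), ?_⟩
  refine Prod.ext hρ ?_
  funext k
  rcases Fin.eq_self_or_eq_succAbove p k with rfl | ⟨j, rfl⟩
  · simp [HF]
  · simp [HF]

theorem HA_zero {n : ℕ} (b : Bool) (x : Equiv.Perm (Fin n) × (Fin n → Bool)) :
    HF 0 b x ∈ HA (n+1) ↔ b = false ∧ x ∈ HA n := by
  simp only [HA, HF, Set.mem_ofPred_eq, HMk_zero, HAv_ins (0 : Fin (n+1)) (by simp)]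
  tauto

theorem HA_one {n : ℕ} (b : Bool) (x : Equiv.Perm (Fin (n+1)) × (Fin (n+1) → Bool)) :
    HF 1 b x ∈ HA (n+2) ↔ x ∈ HB (n+1) := by
  simp only [HA, HB, HF, Set.mem_ofPred_eq, HMk_one, HAv_ins (1 : Fin (n+2)) (by simp)]
  tauto

theorem HB_zero {n : ℕ} (b : Bool) (x : Equiv.Perm (Fin (n+1)) × (Fin (n+1) → Bool)) :
    HF 0 b x ∈ HB (n+2) ↔ b = false ∧ x ∈ HA (n+1) := by
  rw [← HA_zero]
  refine ⟨fun h => h.1, fun h => ⟨h, fun i hi => ?_⟩⟩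
  have hx := ((HA_zero b x).mp h).2
  have : i = (0 : Fin (n+2)).succAbove 0 := Fin.ext (by simpa using hi)
  subst this
  simp only [HF]
  rw [Fin.insertNth_apply_succAbove]
  by_contra hb
  obtain ⟨j, hj, _⟩ := hx.2 0 (by simpa using hb)
  simp at hj

theorem HB_one {n : ℕ} (b : Bool) (x : Equiv.Perm (Fin (n+1)) × (Fin (n+1) → Bool)) :
    HF 1 b x ∈ HB (n+2) ↔ b = false ∧ x ∈ HB (n+1) := by
  rw [← HA_one b x]
  constructor
  · intro h
    refine ⟨?_, h.1⟩
    have := h.2 1 (by simp)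
    simpa [HF] using this
  · rintro ⟨rfl, h⟩
    refine ⟨h, fun i hi => ?_⟩
    have : i = 1 := Fin.ext (by simpa using hi)
    subst this
    simp [HF]

theorem HA_cases {n : ℕ} (y : Equiv.Perm (Fin (n+2)) × (Fin (n+2) → Bool)) (hy : y ∈ HA (n+2)) :
    ∃ b x, HF 0 b x = y ∨ HF 1 b x = y := by
  have h : y.1 (y.1.symm (Fin.last _)) = Fin.last _ := by simp
  have hp := HAv_pos y.1 _ h hy.1
  have : y.1.symm (Fin.last _) = 0 ∨ y.1.symm (Fin.last _) = 1 := by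
    rcases Nat.le_one_iff_eq_zero_or_eq_one.mp hp with h0 | h0
    · left; exact Fin.ext (by simpa using h0)
    · right; exact Fin.ext (by simpa using h0)
  rcases this with e | e <;> rw [e] at h <;> obtain ⟨b, x, hx⟩ := HF_surj _ y h
  · exact ⟨b, x, Or.inl hx⟩
  · exact ⟨b, x, Or.inr hx⟩

theorem HA_eq (n : ℕ) : HA (n+2) = HF 0 false '' HA (n+1) ∪
    (HF 1 true '' HB (n+1) ∪ HF 1 false '' HB (n+1)) := by
  ext y
  constructor
  · intro hy
    obtain ⟨b, x, rfl | rfl⟩ := HA_cases y hy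
    · obtain ⟨rfl, h⟩ := (HA_zero b x).mp hy
      exact Or.inl ⟨x, h, rfl⟩
    · have h := (HA_one b x).mp hy
      right
      cases b
      · exact Or.inr ⟨x, h, rfl⟩
      · exact Or.inl ⟨x, h, rfl⟩
  · rintro (⟨x, h, rfl⟩ | ⟨x, h, rfl⟩ | ⟨x, h, rfl⟩)
    · exact (HA_zero _ x).mpr ⟨rfl, h⟩
    · exact (HA_one _ x).mpr h
    · exact (HA_one _ x).mpr h

theorem HB_eq (n : ℕ) : HB (n+2) = HF 0 false '' HA (n+1) ∪ HF 1 false '' HB (n+1) := by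
  ext y
  constructor
  · intro hy
    obtain ⟨b, x, rfl | rfl⟩ := HA_cases y hy.1
    · obtain ⟨rfl, h⟩ := (HB_zero b x).mp hy
      exact Or.inl ⟨x, h, rfl⟩
    · obtain ⟨rfl, h⟩ := (HB_one b x).mp hy
      exact Or.inr ⟨x, h, rfl⟩
  · rintro (⟨x, h, rfl⟩ | ⟨x, h, rfl⟩)
    · exact (HB_zero _ x).mpr ⟨rfl, h⟩
    · exact (HB_one _ x).mpr ⟨rfl, h⟩

theorem HF_disj {n : ℕ} (p q : Fin (n+1)) (b c : Bool) (h : ¬ (p = q ∧ b = c))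
    (S T : Set (Equiv.Perm (Fin n) × (Fin n → Bool))) : Disjoint (HF p b '' S) (HF q c '' T) := by
  rw [Set.disjoint_left]
  rintro _ ⟨x, _, rfl⟩ ⟨y, _, e⟩
  have := HF_ne _ _ _ _ _ _ e
  exact h ⟨this.1.symm, this.2.symm⟩

theorem HA_rec (n : ℕ) : (HA (n+2)).ncard = (HA (n+1)).ncard + 2 * (HB (n+1)).ncard := by
  rw [HA_eq, Set.ncard_union_eq _ (Set.toFinite _) (Set.toFinite _),
    Set.ncard_union_eq (HF_disj _ _ _ _ (by simp) _ _) (Set.toFinite _) (Set.toFinite _),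
    Set.ncard_image_of_injective _ (HF_inj _ _), Set.ncard_image_of_injective _ (HF_inj _ _),
    Set.ncard_image_of_injective _ (HF_inj _ _)]
  · ring
  · rw [Set.disjoint_union_right]
    exact ⟨HF_disj _ _ _ _ (by simp) _ _, HF_disj _ _ _ _ (by simp) _ _⟩

theorem HB_rec (n : ℕ) : (HB (n+2)).ncard = (HA (n+1)).ncard + (HB (n+1)).ncard := by
  rw [HB_eq, Set.ncard_union_eq (HF_disj _ _ _ _ (by simp) _ _) (Set.toFinite _) (Set.toFinite _),
    Set.ncard_image_of_injective _ (HF_inj _ _), Set.ncard_image_of_injective _ (HF_inj _ _)]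

theorem HA_one_eq : HA 1 = {((1 : Equiv.Perm (Fin 1)), fun _ => false)} := by
  ext ⟨ρ, m⟩
  simp only [Set.mem_singleton_iff]
  constructor
  · rintro ⟨_, h⟩
    refine Prod.ext (Subsingleton.elim _ _) ?_
    funext i
    by_contra hb
    obtain ⟨j, hj, _⟩ := h i (by simpa using hb)
    omega
  · intro h
    rw [h]
    refine ⟨fun i j k hij => ?_, fun i hi => ?_⟩
    · rw [Fin.lt_def] at hij; omega
    · simp at hi

theorem HB_one_eq : HB 1 = HA 1 := by
  ext x
  refine ⟨fun h => h.1, fun h => ⟨h, fun i hi => ?_⟩⟩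
  omega

/-! ### The parking process -/

/-- The occupation state after `k` cars, given the outcome `ρ`. -/
def occK {n : ℕ} (ρ : Equiv.Perm (Fin n)) (k : ℕ) : Fin n → Option (Fin n) :=
  fun s => if (ρ s).val < k then some (ρ s) else none

/-- Local parking condition. -/
def HPk {n : ℕ} (f : Fin n → Fin n) (ρ : Equiv.Perm (Fin n)) (i : Fin n) : Prop :=
  f (ρ i) ≤ i ∧ ∀ s, f (ρ i) ≤ s → s < i → ρ s < ρ i

theorem park_up {n : ℕ} (f : Fin n → Fin n) (ρ : Equiv.Perm (Fin n)) (h : ∀ i, HPk f ρ i) (k : ℕ)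
    (hk : k ≤ n) : parkAux f k = some (occK ρ k) := by
  induction k with
  | zero =>
    rw [parkAux]
    congr 1
  | succ k ih =>
    have hkn : k < n := hk
    rw [parkAux, ih (by omega)]
    simp only [Option.bind_some, dif_pos hkn]
    obtain ⟨i, hi⟩ := ρ.surjective ⟨k, hkn⟩
    have hP := h i
    rw [HPk, hi] at hP
    have hmem : i ∈ Finset.univ.filter fun s => f ⟨k, hkn⟩ ≤ s ∧ occK ρ k s = none := by
      simp [occK, hi, hP.1]
    rw [dif_pos ⟨i, hmem⟩]
    have hmin : (Finset.univ.filter fun s => f ⟨k, hkn⟩ ≤ s ∧ occK ρ k s = none).min' ⟨i, hmem⟩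
        = i := by
      apply le_antisymm
      · exact Finset.min'_le _ _ hmem
      · apply Finset.le_min'
        intro s hs
        simp only [Finset.mem_filter, Finset.mem_univ, true_and] at hs
        by_contra hlt
        have h3 := hP.2 s hs.1 (not_le.mp hlt)
        rw [Fin.lt_def] at h3
        have h4 := hs.2
        simp only [occK] at h4
        rw [if_pos (by simpa using h3)] at h4
        simp at h4
    rw [hmin]
    congr 1
    funext s
    by_cases hs : s = i
    · subst hs; simp [occK, hi]
    · have : (ρ s).val ≠ k := by
        intro e
        apply hs
        apply ρ.injective
        rw [hi]
        exact Fin.ext e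
      rw [Function.update_of_ne hs]
      simp only [occK]
      have : (ρ s).val < k + 1 ↔ (ρ s).val < k := by omega
      simp only [this]

theorem park_step {n : ℕ} (f : Fin n → Fin n) (ρ : Equiv.Perm (Fin n)) (k : ℕ) (hkn : k < n)
    (h : parkAux f (k+1) = some (occK ρ (k+1))) :
    parkAux f k = some (occK ρ k) ∧ ∀ i, (ρ i).val = k → HPk f ρ i := by
  rw [parkAux, Option.bind_eq_some_iff] at h
  obtain ⟨occ, h1, h2⟩ := h
  rw [dif_pos hkn] at h2
  split_ifs at h2 with hS
  have h2 := Option.some.inj h2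
  have hm := Finset.min'_mem _ hS
  have hle : ∀ s ∈ (Finset.univ.filter fun s => f ⟨k, hkn⟩ ≤ s ∧ occ s = none),
      (Finset.univ.filter fun s => f ⟨k, hkn⟩ ≤ s ∧ occ s = none).min' hS ≤ s :=
    fun s hs => Finset.min'_le _ s hs
  generalize (Finset.univ.filter fun s => f ⟨k, hkn⟩ ≤ s ∧ occ s = none).min' hS = i at h2 hm hle
  simp only [Finset.mem_filter, Finset.mem_univ, true_and] at hm hle
  have hi : ρ i = ⟨k, hkn⟩ := by
    have := congrFun h2 i
    rw [Function.update_self] at this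
    simp only [occK] at this
    split_ifs at this with h5
    exact (Option.some.inj this).symm
  have hocc : occ = occK ρ k := by
    funext s
    by_cases hs : s = i
    · subst hs; rw [hm.2]; simp [occK, hi]
    · have hne : (ρ s).val ≠ k := by
        intro e
        apply hs
        apply ρ.injective
        rw [hi]
        exact Fin.ext e
      have := congrFun h2 s
      rw [Function.update_of_ne hs] at this
      rw [this]
      simp only [occK]
      have : (ρ s).val < k + 1 ↔ (ρ s).val < k := by omega
      simp only [this]
  refine ⟨by rw [h1, hocc], ?_⟩
  intro i' hi'
  have : i' = i := by
    apply ρ.injective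
    rw [hi]
    exact Fin.ext hi'
  subst this
  rw [HPk, hi]
  refine ⟨hm.1, fun s hs hlt => ?_⟩
  by_contra hc
  rw [Fin.lt_def] at hc
  have : occ s = none := by
    rw [hocc]
    simp only [occK]
    rw [if_neg (by simpa using hc)]
  exact absurd (hle s ⟨hs, this⟩) (not_le.mpr hlt)

theorem park_iff {n : ℕ} (f : Fin n → Fin n) (ρ : Equiv.Perm (Fin n)) :
    IsParkingPerm f ρ ↔ ∀ i, HPk f ρ i := by
  have hocc : occK ρ n = fun i => some (ρ i) := by
    funext i; simp [occK]
  rw [IsParkingPerm, ← hocc]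
  constructor
  · intro h
    have key : ∀ d k, k + d = n → parkAux f k = some (occK ρ k) := by
      intro d
      induction d with
      | zero => intro k hk; have : k = n := by omega
                subst this; exact h
      | succ d ih =>
        intro k hk
        exact (park_step f ρ k (by omega) (ih (k+1) (by omega))).1
    intro i
    have hi := (ρ i).2
    exact (park_step f ρ (ρ i).val hi (key (n - ((ρ i).val + 1)) _ (by omega))).2 i rfl
  · intro h
    exact park_up f ρ h n le_rfl

theorem HPk_parking {n : ℕ} (f : Fin n → Fin n) (ρ : Equiv.Perm (Fin n)) (h : ∀ i, HPk f ρ i) :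
    IsParkingFunction f := by
  intro i
  have h1 : ((Finset.Iic i).map ρ.toEmbedding).card = i.val + 1 := by simp
  rw [← h1]
  apply Finset.card_le_card
  intro c hc
  simp only [Finset.mem_map, Finset.mem_Iic] at hc
  obtain ⟨j, hj, rfl⟩ := hc
  simp only [Finset.mem_filter, Finset.mem_univ, true_and]
  exact (h j).1.trans hj

theorem perm_unique {n : ℕ} (f : Fin n → Fin n) (ρ ρ' : Equiv.Perm (Fin n))
    (h : IsParkingPerm f ρ) (h' : IsParkingPerm f ρ') : ρ = ρ' := by
  rw [IsParkingPerm] at h h'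
  rw [h] at h'
  ext i
  have := congrFun (Option.some.inj h') i
  rw [Option.some.inj this]

theorem avoids_iff {n : ℕ} (ρ : Equiv.Perm (Fin n)) : AvoidsAll ρ [p123, p213] ↔ HAv ρ := by
  constructor
  · intro h i j k hij hjk h1 h2
    have hik := hij.trans hjk
    have hmono : StrictMono ![i, j, k] := by
      intro a b hab
      fin_cases a <;> fin_cases b <;> simp_all
    rcases lt_trichotomy (ρ i) (ρ j) with h3 | h3 | h3
    · refine h p123 (by simp) ⟨![i, j, k], hmono, ?_⟩
      intro a b
      fin_cases a <;> fin_cases b <;> simp [p123, h1, h2, h3, h1.le, h2.le, h3.le]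
    · exact hij.ne (ρ.injective h3)
    · refine h p213 (by simp) ⟨![i, j, k], hmono, ?_⟩
      intro a b
      fin_cases a <;> fin_cases b <;> simp [p213, h1, h2, h3, h1.le, h2.le, h3.le]
  · intro h σ hσ hc
    obtain ⟨g, hg, hlt⟩ := hc
    have e : σ 0 < σ 2 ∧ σ 1 < σ 2 := by
      simp only [List.mem_cons, List.not_mem_nil, or_false] at hσ
      rcases hσ with rfl | rfl <;> simp [p123, p213]
    exact h (g 0) (g 1) (g 2) (hg (by decide)) (hg (by decide)) ((hlt 0 2).mp e.1)
      ((hlt 1 2).mp e.2)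

/-- The preference function of a marked permutation. -/
def prefOf {n : ℕ} (x : Equiv.Perm (Fin n) × (Fin n → Bool)) (c : Fin n) : Fin n :=
  if x.2 (x.1.symm c) then ⟨(x.1.symm c).val - 1, by have := (x.1.symm c).2; omega⟩ else x.1.symm c

theorem prefOf_HPk {n : ℕ} (x : Equiv.Perm (Fin n) × (Fin n → Bool)) (hx : x ∈ HA n) (i : Fin n) :
    HPk (prefOf x) x.1 i := by
  simp only [HPk, prefOf, Equiv.symm_apply_apply]
  split_ifs with hm
  · refine ⟨by rw [Fin.le_def]; simp, fun s hs hlt => ?_⟩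
    obtain ⟨j, hj, hlt'⟩ := hx.2 i hm
    have : s = j := by
      rw [Fin.le_def] at hs
      rw [Fin.lt_def] at hlt
      simp only at hs
      exact Fin.ext (by omega)
    rw [this]; exact hlt'
  · exact ⟨le_rfl, fun s hs hlt => absurd hs (not_le.mpr hlt)⟩

theorem prefOf_mark {n : ℕ} (x : Equiv.Perm (Fin n) × (Fin n → Bool)) (hx : x ∈ HA n) (i : Fin n) :
    x.2 i = decide (prefOf x (x.1 i) ≠ i) := by
  simp only [prefOf, Equiv.symm_apply_apply]
  split_ifs with hm
  · obtain ⟨j, hj, _⟩ := hx.2 i hm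
    rw [hm]
    symm
    rw [decide_eq_true_iff]
    intro e
    have := congrArg Fin.val e
    simp only at this
    omega
  · simpa using hm

theorem pk_eq (n : ℕ) : pk n [p123, p213] = (HA n).ncard := by
  rw [pk, ← Nat.card_coe_set_eq]
  symm
  refine Nat.card_congr (Equiv.ofBijective (fun x : HA n => ⟨prefOf x.1,
    HPk_parking _ _ (prefOf_HPk x.1 x.2), x.1.1, (park_iff _ _).mpr (prefOf_HPk x.1 x.2),
    (avoids_iff _).mpr x.2.1⟩) ⟨?_, ?_⟩)
  · rintro ⟨x, hx⟩ ⟨y, hy⟩ h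
    have h : prefOf x = prefOf y := congrArg Subtype.val h
    have h1 : x.1 = y.1 := by
      apply perm_unique (prefOf x)
      · exact (park_iff _ _).mpr (prefOf_HPk x hx)
      · rw [h]; exact (park_iff _ _).mpr (prefOf_HPk y hy)
    apply Subtype.ext
    refine Prod.ext h1 ?_
    funext i
    rw [prefOf_mark x hx, prefOf_mark y hy, h, h1]
  · rintro ⟨f, _, ρ, hρ, hav⟩
    rw [park_iff] at hρ
    rw [avoids_iff] at hav
    -- a car moves forward by at most one spot
    have hstep : ∀ i, f (ρ i) ≠ i → (f (ρ i)).val + 1 = i.val := by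
      intro i hne
      have h1 := (hρ i).1
      have h2 : f (ρ i) < i := lt_of_le_of_ne h1 hne
      rw [Fin.lt_def] at h2
      by_contra hc
      have hi := i.2
      have hj : (⟨i.val - 1, by omega⟩ : Fin n) < i := by rw [Fin.lt_def]; simp; omega
      have hfj : f (ρ i) < (⟨i.val - 1, by omega⟩ : Fin n) := by
        rw [Fin.lt_def]; simp only; omega
      exact hav (f (ρ i)) ⟨i.val - 1, by omega⟩ i hfj hj
        ((hρ i).2 _ le_rfl (hfj.trans hj)) ((hρ i).2 _ hfj.le hj)
    refine ⟨⟨(ρ, fun i => decide (f (ρ i) ≠ i)), hav, ?_⟩, ?_⟩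
    · intro i hi
      have hi : f (ρ i) ≠ i := by simpa using hi
      exact ⟨f (ρ i), hstep i hi, (hρ i).2 _ le_rfl (lt_of_le_of_ne (hρ i).1 hi)⟩
    · apply Subtype.ext
      funext c
      obtain ⟨i, rfl⟩ := ρ.surjective c
      simp only [prefOf, Equiv.symm_apply_apply]
      by_cases hi : f (ρ i) = i
      · simp [hi]
      · rw [if_pos (by simpa using hi)]
        have := hstep i hi
        exact Fin.ext (by simp only; omega)

theorem HB_ncard_one : (HB 1).ncard = 1 := by
  rw [HB_one_eq, HA_one_eq, Set.ncard_singleton]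

theorem pk_one : pk 1 [p123, p213] = 1 := by
  rw [pk_eq, HA_one_eq, Set.ncard_singleton]

theorem pk_two : pk 2 [p123, p213] = 3 := by
  have h : (HA 2).ncard = (HA 1).ncard + 2 * (HB 1).ncard := HA_rec 0
  have h1 := pk_one
  rw [pk_eq] at h1 ⊢
  rw [HB_ncard_one] at h
  omega

theorem pk_rec (m : ℕ) : pk (m + 3) [p123, p213] =
    2 * pk (m + 2) [p123, p213] + pk (m + 1) [p123, p213] := by
  have h1 := HA_rec m
  have h2 := HA_rec (m+1)
  have h3 := HB_rec m
  simp only [pk_eq]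
  rw [show m + 1 + 2 = m + 3 from rfl, show m + 1 + 1 = m + 2 from rfl] at h2
  omega

theorem pk_closed (m : ℕ) : ((pk (m + 1) [p123, p213] : ℝ) =
      1 / 2 * (1 - Real.sqrt 2) ^ (m+1) + 1 / 2 * (1 + Real.sqrt 2) ^ (m+1)) ∧
    ((pk (m + 2) [p123, p213] : ℝ) =
      1 / 2 * (1 - Real.sqrt 2) ^ (m+2) + 1 / 2 * (1 + Real.sqrt 2) ^ (m+2)) := by
  have hs : Real.sqrt 2 ^ 2 = 2 := Real.sq_sqrt (by norm_num)
  induction m with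
  | zero =>
    simp only [Nat.zero_add, pk_one, pk_two]
    constructor
    · push_cast; ring
    · push_cast; linear_combination -hs
  | succ m ih =>
    refine ⟨ih.2, ?_⟩
    have := pk_rec m
    rw [show m + 1 + 2 = m + 3 from rfl, this]
    push_cast
    rw [ih.1, ih.2]
    generalize Real.sqrt 2 = s at hs
    have e1 : (1 - s) ^ (m + 3) = (1 - s) ^ (m + 1) * (1 - s) ^ 2 := by ring
    have e2 : (1 + s) ^ (m + 3) = (1 + s) ^ (m + 1) * (1 + s) ^ 2 := by ring
    have e3 : (1 - s) ^ (m + 2) = (1 - s) ^ (m + 1) * (1 - s) := by ring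
    have e4 : (1 + s) ^ (m + 2) = (1 + s) ^ (m + 1) * (1 + s) := by ring
    rw [e1, e2, e3, e4]
    linear_combination (-(1 / 2) * (1 - s) ^ (m + 1) - 1 / 2 * (1 + s) ^ (m + 1)) * hs

theorem stmt17 (n : ℕ) (hn : 1 ≤ n) :
    ((pk n [p123, p213] : ℝ) =
      1 / 2 * (1 - Real.sqrt 2) ^ n + 1 / 2 * (1 + Real.sqrt 2) ^ n) ∧
    pk 1 [p123, p213] = 1 ∧ pk 2 [p123, p213] = 3 ∧
    (∀ m : ℕ, 2 ≤ m →
      pk (m + 1) [p123, p213] = 2 * pk m [p123, p213] + pk (m - 1) [p123, p213]) := by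
  obtain ⟨k, rfl⟩ : ∃ k, n = k + 1 := ⟨n - 1, by omega⟩
  refine ⟨(pk_closed k).1, pk_one, pk_two, ?_⟩
  intro m hm
  obtain ⟨j, rfl⟩ : ∃ j, m = j + 2 := ⟨m - 2, by omega⟩
  exact pk_rec j
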